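/- Let k be a perfect field such that for every positive integer m there are only finitely many intermediate fields of the extension k̄/k (k̄ an algebraic closure of k) of degree m over k. Then for every positive integer n, the group GL_n(k) has only finitely many z-classes. -/

import Mathlib

/-- Two elements of a group are *z-equivalent* if their centralizers are conjugate:
there is `a` with `a ⬝ Z(g) ⬝ a⁻¹ = Z(h)`. -/
def IsZEquiv {G : Type*} [Group G] (g h : G) : Prop :=
  ∃ a : G, ∀ x : G, x ∈ Subgroup.centralizer {g} ↔ a * x * a⁻¹ ∈ Subgroup.centralizer {h}

namespace ZClass

open Polynomial Module IntermediateField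

section Truncation

variable {k K : Type*} [Field k] [Field K] [Algebra k K]

theorem aeval_X_add_C_eq_taylor (α : K) (q : k[X]) :
    aeval (X + C α) q = taylor α (q.map (algebraMap k K)) := by
  rw [taylor_apply, comp, eval₂_map, aeval_def]
  congr 1

theorem coeff_zero_aeval_X_add_C (α : K) (q : k[X]) :
    (aeval (X + C α) q).coeff 0 = aeval α q := by
  rw [aeval_X_add_C_eq_taylor, taylor_coeff_zero, eval_map_algebraMap]

/-- Since `p` is separable, expanding at a root `α` of `p` turns the `p`-adic valuation into the
order of vanishing at `α`. -/
theorem X_pow_dvd_aeval_X_add_C_iff [PerfectField k] {p : k[X]} (hp : Irreducible p) {α : K}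
    (hα : aeval α p = 0) (e : ℕ) (f : k[X]) : X ^ e ∣ aeval (X + C α) f ↔ p ^ e ∣ f := by
  have hXp : X ∣ aeval (X + C α) p := by
    rw [X_dvd_iff, coeff_zero_aeval_X_add_C, hα]
  constructor
  · intro h
    by_cases hf : f = 0
    · simp [hf]
    obtain ⟨m, u, hu, rfl⟩ := WfDvdMonoid.max_power_factor hf hp
    obtain ⟨v, hv⟩ := hXp
    have hv0 : v.coeff 0 ≠ 0 := by
      rw [← coeff_X_mul, ← hv, aeval_X_add_C_eq_taylor, taylor_coeff_one, derivative_map,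
        eval_map_algebraMap]
      exact (PerfectField.separable_of_irreducible hp).aeval_derivative_ne_zero hα
    have hu0 : (aeval (X + C α) u).coeff 0 ≠ 0 := by
      rw [coeff_zero_aeval_X_add_C]
      intro h0
      obtain ⟨a, b, hab⟩ := (hp.coprime_iff_not_dvd).2 hu
      simpa [hα, h0] using congrArg (aeval α) hab
    suffices e ≤ m from (pow_dvd_pow p this).trans (dvd_mul_right _ _)
    by_contra! hm
    rw [map_mul, map_pow, hv, mul_pow, mul_assoc] at h
    have h1 := (pow_dvd_pow X (Nat.succ_le_of_lt hm)).trans h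
    rw [pow_succ, mul_dvd_mul_iff_left (pow_ne_zero _ X_ne_zero), X_dvd_iff, mul_coeff_zero,
      coeff_zero_eq_eval_zero (v ^ m), eval_pow, ← coeff_zero_eq_eval_zero] at h1
    exact mul_ne_zero (pow_ne_zero _ hv0) hu0 h1
  · rintro ⟨u, rfl⟩
    rw [map_mul, map_pow]
    exact (pow_dvd_pow_of_dvd hXp e).trans (dvd_mul_right _ _)

variable (K) in
/-- The truncated polynomial ring `K[X] / (X ^ e)`. -/
abbrev Trunc (e : ℕ) : Type _ := K[X] ⧸ Ideal.span {(X : K[X]) ^ e}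

theorem finrank_trunc (e : ℕ) : finrank k (Trunc K e) = finrank k K * e := by
  rw [← finrank_mul_finrank k K (Trunc K e), finrank_quotient_span_eq_natDegree, natDegree_X_pow]

instance finite_trunc [FiniteDimensional k K] (e : ℕ) : FiniteDimensional k (Trunc K e) := by
  have : FiniteDimensional K (Trunc K e) := (monic_X_pow e).finite_quotient
  exact Module.Finite.trans K _

/-- The `k`-algebra map `k[X] / (p ^ e) → K[X] / (X ^ e)` sending `X` to `X + α`. -/
noncomputable def quotToTrunc {p : k[X]} {α : K} (hα : aeval α p = 0) (e : ℕ) :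
    (k[X] ⧸ Ideal.span {p ^ e}) →ₐ[k] Trunc K e :=
  Ideal.quotientMapₐ _ (aeval (X + C α)) (by
    rw [Ideal.span_singleton_le_iff_mem, Ideal.mem_comap, Ideal.mem_span_singleton, map_pow]
    refine pow_dvd_pow_of_dvd ?_ e
    rw [X_dvd_iff, coeff_zero_aeval_X_add_C, hα])

theorem quotToTrunc_mk {p : k[X]} {α : K} (hα : aeval α p = 0) (e : ℕ) (f : k[X]) :
    quotToTrunc hα e (Ideal.Quotient.mk _ f) = Ideal.Quotient.mk _ (aeval (X + C α) f) := rfl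

theorem quotToTrunc_injective [PerfectField k] {p : k[X]} (hp : Irreducible p) {α : K}
    (hα : aeval α p = 0) (e : ℕ) : Function.Injective (quotToTrunc hα e) := by
  rw [injective_iff_map_eq_zero]
  intro x hx
  obtain ⟨f, rfl⟩ := Ideal.Quotient.mk_surjective x
  rw [quotToTrunc_mk, Ideal.Quotient.eq_zero_iff_mem, Ideal.mem_span_singleton,
    X_pow_dvd_aeval_X_add_C_iff hp hα] at hx
  rwa [Ideal.Quotient.eq_zero_iff_mem, Ideal.mem_span_singleton]

theorem quotToTrunc_bijective [PerfectField k] [FiniteDimensional k K] {p : k[X]}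
    (hp : Irreducible p) {α : K} (hα : aeval α p = 0) (hK : k⟮α⟯ = ⊤) (e : ℕ) :
    Function.Bijective (quotToTrunc hα e) := by
  have hinj := quotToTrunc_injective hp hα e
  refine ⟨hinj, ?_⟩
  have : FiniteDimensional k (k[X] ⧸ Ideal.span {p ^ e}) :=
    Module.Finite.of_injective (quotToTrunc hα e).toLinearMap hinj
  refine (LinearMap.injective_iff_surjective_of_finrank_eq_finrank
    (f := (quotToTrunc hα e).toLinearMap) ?_).1 hinj
  rw [finrank_trunc, finrank_quotient_span_eq_natDegree, natDegree_pow, mul_comm, ← finrank_top',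
    ← hK, adjoin.finrank (Algebra.IsIntegral.isIntegral α), ← minpoly.eq_of_irreducible hp hα,
    natDegree_mul_C (inv_ne_zero (leadingCoeff_ne_zero.2 hp.ne_zero))]

end Truncation

section Interpolation

variable {k L : Type*} [Field k] [PerfectField k] [Field L] [Algebra k L]
  [Algebra.IsAlgebraic k L]

omit [PerfectField k] [Algebra.IsAlgebraic k L] in
theorem adjoin_gen_eq_top (α : L) : k⟮AdjoinSimple.gen k α⟯ = ⊤ := by
  apply lift_injective
  rw [lift_adjoin_simple, lift_top, AdjoinSimple.coe_gen]

omit [PerfectField k] [Algebra.IsAlgebraic k L] in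
theorem mapAlgHom_aeval_X_add_C {K : IntermediateField k L} (γ : K) (F : k[X]) :
    mapAlgHom K.val (aeval (X + C γ) F) = aeval (X + C (γ : L)) F := by
  rw [← aeval_algHom_apply]
  simp

theorem exists_aeval_X_add_C {α β : L} (hβ : β ∈ k⟮α⟯) (e : ℕ) :
    ∃ F : k[X], X ^ e ∣ aeval (X + C α) F - (X + C β) := by
  have hα := Algebra.IsIntegral.isIntegral (R := k) α
  have := adjoin.finiteDimensional hα
  have hγ : aeval (AdjoinSimple.gen k α) (minpoly k α) = 0 := by
    rw [← minpoly_gen k α]; exact minpoly.aeval _ _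
  obtain ⟨x, hx⟩ := (quotToTrunc_bijective (minpoly.irreducible hα) hγ (adjoin_gen_eq_top α) e).2 (Ideal.Quotient.mk _ (X + C ⟨β, hβ⟩))
  obtain ⟨F, rfl⟩ := Ideal.Quotient.mk_surjective x
  refine ⟨F, ?_⟩
  rw [quotToTrunc_mk, Ideal.Quotient.eq, Ideal.mem_span_singleton] at hx
  have h := map_dvd (mapAlgHom (k⟮α⟯.val)) hx
  rw [map_sub, mapAlgHom_aeval_X_add_C] at h
  simpa using h

theorem exists_forall_aeval_X_add_C {ι : Type*} [Finite ι] {α β : ι → L} (hβ : ∀ i, β i ∈ k⟮α i⟯)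
    (hαβ : ∀ i j, α i = α j → β i = β j)
    (hα : ∀ i j, minpoly k (α i) = minpoly k (α j) → α i = α j) (e : ℕ) :
    ∃ F : k[X], ∀ i, X ^ e ∣ aeval (X + C (α i)) F - (X + C (β i)) := by
  choose G hG using fun i => exists_aeval_X_add_C (hβ i) e
  choose s hs using fun t : Set.range α => t.2
  have hcop : Pairwise (Function.onFun IsCoprime fun t : Set.range α =>
      Ideal.span {minpoly k (t : L) ^ e}) := by
    intro t u htu
    rw [Function.onFun, Ideal.isCoprime_span_singleton_iff]
    have hint (x : L) := Algebra.IsIntegral.isIntegral (R := k) x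
    refine ((minpoly.irreducible (hint _)).coprime_iff_not_dvd.2 fun hdvd => htu ?_).pow
    have := eq_of_monic_of_associated (minpoly.monic (hint _)) (minpoly.monic (hint _))
      ((minpoly.irreducible (hint _)).associated_of_dvd (minpoly.irreducible (hint _)) hdvd)
    rw [← hs t, ← hs u] at this
    exact Subtype.ext (by rw [← hs t, ← hs u, hα _ _ this])
  obtain ⟨F, hF⟩ := Ideal.exists_forall_sub_mem_ideal hcop fun t => G (s t)
  refine ⟨F, fun i => ?_⟩
  have hi : α (s ⟨α i, i, rfl⟩) = α i := hs ⟨α i, i, rfl⟩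
  have h1 := hF ⟨α i, i, rfl⟩
  have h2 := hG (s ⟨α i, i, rfl⟩)
  rw [Ideal.mem_span_singleton, ← X_pow_dvd_aeval_X_add_C_iff
    (minpoly.irreducible (Algebra.IsIntegral.isIntegral _)) (minpoly.aeval _ _), map_sub] at h1
  rw [hi, hαβ _ _ hi] at h2
  simpa using dvd_add h1 h2

end Interpolation

section Model

variable {k L V ι : Type*} [Field k] [Field L] [Algebra k L] [AddCommGroup V] [Module k V]

/-- `P` identifies the endomorphism `g` with multiplication by `(X + α i)_i` on
`∏ i, K i [X] / (X ^ e i)`. -/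
def IsModel (g : Module.End k V) (K : ι → IntermediateField k L) (e : ι → ℕ) (α : ∀ i, K i)
    (P : V ≃ₗ[k] ∀ i, Trunc (K i) (e i)) : Prop :=
  ∀ v i, P (g v) i = Ideal.Quotient.mk _ (X + C (α i)) * P v i

/-- `g` has a model given by generators `α i` of the fields `K i`, where `rel` records which of
the `α i` coincide. -/
def HasModel (g : Module.End k V) (K : ι → IntermediateField k L) (e : ι → ℕ)
    (rel : ι → ι → Prop) : Prop :=
  ∃ (α : ∀ i, K i) (P : V ≃ₗ[k] ∀ i, Trunc (K i) (e i)), IsModel g K e α P ∧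
    (∀ i, k⟮(α i : L)⟯ = K i) ∧ (∀ i j, rel i j ↔ (α i : L) = α j) ∧
    ∀ i j, minpoly k (α i : L) = minpoly k (α j : L) → (α i : L) = α j

theorem aeval_C_mul_X_pow_succ {A : Type*} [Ring A] [Algebra k A] (x : A) (a : k) (n : ℕ) :
    aeval x (C a * X ^ (n + 1)) = aeval x (C a * X ^ n) * x := by
  rw [pow_succ, ← mul_assoc, map_mul, aeval_X]

theorem IsModel.aeval {g : Module.End k V} {K : ι → IntermediateField k L} {e : ι → ℕ}
    {α : ∀ i, K i} {P : V ≃ₗ[k] ∀ i, Trunc (K i) (e i)} (h : IsModel g K e α P) (F : k[X]) (v : V)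
    (i : ι) : P (Polynomial.aeval g F v) i =
      Ideal.Quotient.mk _ (Polynomial.aeval (X + C (α i)) F) * P v i := by
  induction F using Polynomial.induction_on generalizing v with
  | C a =>
    simp only [aeval_C, Module.algebraMap_end_apply, map_smul, Pi.smul_apply]
    exact Algebra.smul_def a (P v i)
  | add F G hF hG => simp only [map_add, LinearMap.add_apply, Pi.add_apply, hF, hG, add_mul]
  | monomial n a ih =>
    rw [aeval_C_mul_X_pow_succ, aeval_C_mul_X_pow_succ, Module.End.mul_apply, ih, h, ← mul_assoc,
      ← map_mul (Ideal.Quotient.mk _)]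

theorem IsModel.exists_conj_eq_aeval [PerfectField k] [Algebra.IsAlgebraic k L] [Finite ι]
    {g h : Module.End k V} {K : ι → IntermediateField k L} {e : ι → ℕ} {α β : ∀ i, K i}
    {P Q : V ≃ₗ[k] ∀ i, Trunc (K i) (e i)} (hg : IsModel g K e α P) (hh : IsModel h K e β Q)
    (hK : ∀ i, k⟮(β i : L)⟯ = K i) (hβα : ∀ i j, (β i : L) = β j → (α i : L) = α j)
    (hβ : ∀ i j, minpoly k (β i : L) = minpoly k (β j : L) → (β i : L) = β j) :
    ∃ F : k[X], ∀ v, Q.symm (P (g v)) = Polynomial.aeval h F (Q.symm (P v)) := by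
  obtain ⟨N, hN⟩ := (Set.finite_range e).bddAbove
  obtain ⟨F, hF⟩ := exists_forall_aeval_X_add_C (α := fun i => (β i : L)) (β := fun i => (α i : L))
    (fun i => by rw [hK]; exact (α i).2) hβα hβ N
  refine ⟨F, fun v => ?_⟩
  rw [LinearEquiv.symm_apply_eq]
  funext i
  rw [hg, hh.aeval, LinearEquiv.apply_symm_apply]
  congr 1
  symm
  rw [Ideal.Quotient.eq, Ideal.mem_span_singleton, X_pow_dvd_iff]
  intro d hd
  have h1 := X_pow_dvd_iff.1 ((pow_dvd_pow X (hN ⟨i, rfl⟩)).trans (hF i)) d hd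
  rw [← mapAlgHom_aeval_X_add_C] at h1
  apply (K i).val.injective
  rw [map_zero, coeff_sub, map_sub, ← h1, coeff_sub]
  congr 1
  · exact (coeff_map _ _).symm
  · simp only [coeff_add, coeff_X, coeff_C]
    split_ifs <;> simp

theorem HasModel.exists_conj_eq_aeval [PerfectField k] [Algebra.IsAlgebraic k L] [Finite ι]
    {g h : Module.End k V} {K : ι → IntermediateField k L} {e : ι → ℕ} {rel : ι → ι → Prop}
    (hg : HasModel g K e rel) (hh : HasModel h K e rel) :
    ∃ (T : V ≃ₗ[k] V) (F G : k[X]), (∀ v, T (g v) = Polynomial.aeval h F (T v)) ∧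
      ∀ v, T.symm (h v) = Polynomial.aeval g G (T.symm v) := by
  obtain ⟨α, P, hP, hKα, hrα, hα⟩ := hg
  obtain ⟨β, Q, hQ, hKβ, hrβ, hβ⟩ := hh
  obtain ⟨F, hF⟩ := hP.exists_conj_eq_aeval hQ hKβ
    (fun i j hij => (hrα i j).1 ((hrβ i j).2 hij)) hβ
  obtain ⟨G, hG⟩ := hQ.exists_conj_eq_aeval hP hKα
    (fun i j hij => (hrβ i j).1 ((hrα i j).2 hij)) hα
  exact ⟨P.trans Q.symm, F, G, hF, hG⟩

theorem HasModel.reindex {κ : Type*} {g : Module.End k V} {K : ι → IntermediateField k L}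
    {e : ι → ℕ} {rel : ι → ι → Prop} (h : HasModel g K e rel) (σ : κ ≃ ι) :
    HasModel g (K ∘ σ) (e ∘ σ) (fun i j => rel (σ i) (σ j)) := by
  obtain ⟨α, P, hP, hK, hr, hα⟩ := h
  refine ⟨fun i => α (σ i),
    P.trans (LinearEquiv.piCongrLeft k (fun i => Trunc (K i) (e i)) σ).symm, fun v i => ?_,
    fun i => hK _, fun i j => hr _ _, fun i j => hα _ _⟩
  exact hP v (σ i)

/-- Components with exponent zero may be dropped from a model. -/
theorem HasModel.restrict {g : Module.End k V} {K : ι → IntermediateField k L}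
    {e : ι → ℕ} {rel : ι → ι → Prop} (h : HasModel g K e rel) :
    HasModel g (fun i : {i // e i ≠ 0} => K i) (fun i => e i) (fun i j => rel i j) := by
  obtain ⟨α, P, hP, hK, hr, hα⟩ := h
  let R : (∀ i, Trunc (K i) (e i)) →ₗ[k] ∀ i : {i // e i ≠ 0}, Trunc (K i) (e i) :=
    LinearMap.pi fun i => LinearMap.proj (i : ι)
  have hR : Function.Bijective R := by
    constructor
    · intro x y hxy
      funext i
      by_cases hi : e i = 0
      · have : Subsingleton (Trunc (K i) (e i)) := by
          rw [Ideal.Quotient.subsingleton_iff, hi, pow_zero, Ideal.span_singleton_one]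
        exact Subsingleton.elim _ _
      · exact congrFun hxy ⟨i, hi⟩
    · intro y
      refine ⟨fun i => if hi : e i = 0 then 0 else y ⟨i, hi⟩, ?_⟩
      funext i
      exact dif_neg i.2
  refine ⟨fun i => α i, P.trans (LinearEquiv.ofBijective R hR), fun v i => hP v i,
    fun i => hK _, fun i j => hr _ _, fun i j => hα _ _⟩

theorem HasModel.finrank_eq [Fintype ι] {g : Module.End k V}
    {K : ι → IntermediateField k L} [∀ i, FiniteDimensional k (K i)] {e : ι → ℕ}
    {rel : ι → ι → Prop} (h : HasModel g K e rel) :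
    finrank k V = ∑ i, finrank k (K i) * e i := by
  obtain ⟨α, P, -⟩ := h
  rw [P.finrank_eq, finrank_pi_fintype]
  simp_rw [finrank_trunc]

theorem HasModel.finiteDimensional [Algebra.IsAlgebraic k L] {g : Module.End k V}
    {K : ι → IntermediateField k L} {e : ι → ℕ} {rel : ι → ι → Prop} (h : HasModel g K e rel)
    (i : ι) : FiniteDimensional k (K i) := by
  obtain ⟨α, P, -, hK, -⟩ := h
  rw [← hK]
  exact adjoin.finiteDimensional (Algebra.IsIntegral.isIntegral _)

theorem isTorsion_aeval' [FiniteDimensional k V] (g : Module.End k V) :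
    Module.IsTorsion k[X] (AEval' g) := by
  intro x
  refine ⟨⟨g.charpoly, mem_nonZeroDivisors_of_ne_zero g.charpoly_monic.ne_zero⟩, ?_⟩
  obtain ⟨v, rfl⟩ := (AEval'.of g).surjective x
  change g.charpoly • AEval'.of g v = 0
  rw [← AEval.of_aeval_smul, g.aeval_self_charpoly, zero_smul, map_zero]

end Model

section Existence

universe u v

variable {k : Type u} {V : Type v} [Field k] [PerfectField k] [AddCommGroup V] [Module k V]
  [FiniteDimensional k V]

theorem exists_hasModel (L : Type*) [Field L] [Algebra k L] [IsAlgClosure k L]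
    (g : Module.End k V) :
    ∃ (ι : Type u) (_ : Fintype ι) (K : ι → IntermediateField k L) (e : ι → ℕ)
      (rel : ι → ι → Prop), HasModel g K e rel := by
  classical
  have := IsAlgClosure.isAlgClosed k (K := L)
  have := IsAlgClosure.isAlgebraic (R := k) (K := L)
  obtain ⟨ι, _, p, hp, e, ⟨S⟩⟩ := equiv_directSum_of_isTorsion (isTorsion_aeval' g)
  have hroot (q : k[X]) : ∃ x : L, Irreducible q → aeval x q = 0 := by
    by_cases hq : Irreducible q
    · obtain ⟨x, hx⟩ := IsAlgClosed.exists_aeval_eq_zero L q hq.degree_pos.ne'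
      exact ⟨x, fun _ => hx⟩
    · exact ⟨0, fun h => absurd h hq⟩
  choose ρ hρ using hroot
  let α (i : ι) : L := ρ (normalize (p i))
  have hα (i : ι) : aeval (α i) (p i) = 0 := by
    have := hρ (normalize (p i)) ((associated_normalize (p i)).irreducible (hp i))
    exact eq_zero_of_zero_dvd (this ▸ map_dvd (aeval (α i)) (normalize_associated (p i)).dvd)
  have hγ (i : ι) : aeval (AdjoinSimple.gen k (α i)) (p i) = 0 := by
    have h := aeval_algHom_apply (k⟮α i⟯).val (AdjoinSimple.gen k (α i)) (p i)
    exact (k⟮α i⟯).val.injective (h.symm.trans ((hα i).trans (map_zero _).symm))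
  have hfin (i : ι) : FiniteDimensional k k⟮α i⟯ :=
    adjoin.finiteDimensional (Algebra.IsIntegral.isIntegral _)
  let E (i : ι) := AlgEquiv.ofBijective _
    (quotToTrunc_bijective (hp i) (hγ i) (adjoin_gen_eq_top (α i)) (e i))
  let S' := (S.trans (DirectSum.linearEquivFunOnFintype k[X] ι _)).restrictScalars k
  let P : V ≃ₗ[k] ∀ i, Trunc k⟮α i⟯ (e i) :=
    (AEval'.of g).trans (S'.trans (LinearEquiv.piCongrRight fun i => (E i).toLinearEquiv))
  refine ⟨ι, inferInstance, fun i => k⟮α i⟯, e, fun i j => α i = α j,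
    fun i => AdjoinSimple.gen k (α i), P, fun v i => ?_, fun i => rfl, fun i j => Iff.rfl,
    fun i j hij => ?_⟩
  · have h1 : S' (AEval'.of g (g v)) i = Ideal.Quotient.mk _ X * S' (AEval'.of g v) i := by
      rw [← AEval'.X_smul_of]
      change (S.trans (DirectSum.linearEquivFunOnFintype k[X] ι _)) (X • _) i = _
      rw [map_smul]
      rfl
    change E i (S' (AEval'.of g (g v)) i) = _ * E i (S' (AEval'.of g v) i)
    rw [h1, map_mul]
    congr 1
    change Ideal.Quotient.mk _ (aeval _ X) = _
    rw [aeval_X]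
  · change ρ _ = ρ _
    congr 1
    change minpoly k (α i) = minpoly k (α j) at hij
    rw [← minpoly.eq_of_irreducible (hp i) (hα i), ← minpoly.eq_of_irreducible (hp j) (hα j)] at hij
    have hassoc (l : ι) : Associated (p l * C (p l).leadingCoeff⁻¹) (p l) :=
      associated_mul_unit_left _ _ (isUnit_C.2
        (isUnit_iff_ne_zero.2 (inv_ne_zero (leadingCoeff_ne_zero.2 (hp l).ne_zero))))
    exact normalize_eq_normalize_iff_associated.2 ((hassoc i).symm.trans (hij ▸ hassoc j))

theorem exists_hasModel_fin (L : Type*) [Field L] [Algebra k L] [IsAlgClosure k L]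
    (g : Module.End k V) :
    ∃ (r : Fin (finrank k V + 1)) (K : Fin r → IntermediateField k L)
      (e : Fin r → Fin (finrank k V + 1)) (rel : Fin r → Fin r → Prop),
      HasModel g K (fun i => e i) rel ∧
        ∀ i, finrank k (K i) ∈ Finset.Icc 1 (finrank k V) := by
  classical
  have := IsAlgClosure.isAlgebraic (R := k) (K := L)
  obtain ⟨ι, _, K, e, rel, h⟩ := exists_hasModel L g
  let σ := (Fintype.equivFin {i // e i ≠ 0}).symm
  have h' := h.restrict.reindex σ
  have hfin (i) : FiniteDimensional k (K (σ i)) := h'.finiteDimensional i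
  have hsum : finrank k V = ∑ i, finrank k (K (σ i)) * e (σ i) :=
    have := h'.finiteDimensional
    h'.finrank_eq
  have hpos (i) : 0 < finrank k (K (σ i)) := finrank_pos
  have hepos (i) : 0 < e (σ i) := Nat.pos_of_ne_zero (σ i).2
  have hle (i) : finrank k (K (σ i)) * e (σ i) ≤ finrank k V := by
    rw [hsum]
    exact Finset.single_le_sum (f := fun i => finrank k (K (σ i)) * e (σ i))
      (fun _ _ => Nat.zero_le _) (Finset.mem_univ i)
  have hr : Fintype.card {i // e i ≠ 0} ≤ finrank k V := by
    rw [hsum]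
    calc _ = ∑ i : Fin (Fintype.card {i // e i ≠ 0}), 1 := by simp
      _ ≤ _ := Finset.sum_le_sum fun i _ => Nat.mul_pos (hpos i) (hepos i)
  refine ⟨⟨_, Nat.lt_succ_of_le hr⟩, _, fun i => ⟨e (σ i), Nat.lt_succ_of_le
    ((Nat.le_mul_of_pos_left _ (hpos i)).trans (hle i))⟩, _, h', fun i => ?_⟩
  exact Finset.mem_Icc.2 ⟨hpos i, (Nat.le_mul_of_pos_right _ (hepos i)).trans (hle i)⟩

end Existence

section Group

theorem isZEquiv_of_commute {G : Type*} [Group G] {g h a : G}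
    (h₁ : ∀ x, Commute x h → Commute x (a * g * a⁻¹))
    (h₂ : ∀ x, Commute x g → Commute x (a⁻¹ * h * a)) : IsZEquiv g h := by
  refine ⟨a, fun x => ?_⟩
  simp only [Subgroup.mem_centralizer_singleton_iff]
  constructor
  · intro hx
    have := congrArg (fun y => a * y * a⁻¹) (h₂ x hx).eq
    simpa [mul_assoc] using this
  · intro hx
    have := congrArg (fun y => a⁻¹ * y * a) (h₁ _ hx).eq
    simpa [mul_assoc] using this

theorem _root_.IsZEquiv.symm {G : Type*} [Group G] {g h : G} : IsZEquiv g h → IsZEquiv h g := by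
  rintro ⟨a, ha⟩
  refine ⟨a⁻¹, fun x => ?_⟩
  rw [ha]
  simp [mul_assoc]

theorem _root_.IsZEquiv.trans {G : Type*} [Group G] {g h l : G} :
    IsZEquiv g h → IsZEquiv h l → IsZEquiv g l := by
  rintro ⟨a, ha⟩ ⟨b, hb⟩
  refine ⟨b * a, fun x => ?_⟩
  rw [ha, hb]
  simp [mul_assoc]

theorem isZEquiv_of_conj_eq_aeval {k m : Type*} [Field k] [Fintype m] [DecidableEq m]
    {g h : GL m k} {T : (m → k) ≃ₗ[k] (m → k)} {F G : k[X]}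
    (hF : ∀ v, T (Matrix.toLin' g.1 v) = aeval (Matrix.toLin' h.1) F (T v))
    (hG : ∀ v, T.symm (Matrix.toLin' h.1 v) = aeval (Matrix.toLin' g.1) G (T.symm v)) :
    IsZEquiv g h := by
  let t := LinearMap.GeneralLinearGroup.ofLinearEquiv T
  obtain ⟨a, ha⟩ := Matrix.GeneralLinearGroup.toLin.surjective t
  have ha1 (v) : Matrix.toLin' a.1 v = T v :=
    congrArg (fun s : LinearMap.GeneralLinearGroup k (m → k) => s.1 v) ha
  have ha2 (v) : Matrix.toLin' (a⁻¹).1 v = T.symm v := by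
    rw [LinearEquiv.eq_symm_apply, ← ha1, ← LinearMap.comp_apply, ← Matrix.toLin'_mul,
      ← Units.val_mul, mul_inv_cancel, Units.val_one, Matrix.toLin'_one, LinearMap.id_apply]
  have key (x y b : GL m k) (F : k[X]) (hxy : Commute x y)
      (hb : Matrix.toLin' b.1 = aeval (Matrix.toLin' y.1) F) : Commute x b := by
    have h1 : Commute (Matrix.toLin' x.1) (Matrix.toLin' y.1) := by
      rw [Commute, SemiconjBy, Module.End.mul_eq_comp, Module.End.mul_eq_comp,
        ← Matrix.toLin'_mul, ← Matrix.toLin'_mul, ← Units.val_mul, ← Units.val_mul, hxy.eq]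
    have h2 : Commute (Matrix.toLin' x.1) (Matrix.toLin' b.1) := by
      rw [hb]
      exact Algebra.commute_of_mem_adjoin_singleton_of_commute
        (aeval_mem_adjoin_singleton _ _) h1
    rw [Commute, SemiconjBy, Module.End.mul_eq_comp, Module.End.mul_eq_comp,
        ← Matrix.toLin'_mul, ← Matrix.toLin'_mul] at h2
    exact Units.ext (Matrix.toLin'.injective h2)
  refine isZEquiv_of_commute (a := a) (fun x hx => key x h _ F hx ?_) fun x hx => key x g _ G hx ?_
  · refine LinearMap.ext fun v => ?_
    rw [Units.val_mul, Units.val_mul, Matrix.toLin'_mul, Matrix.toLin'_mul, LinearMap.comp_apply,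
      LinearMap.comp_apply, ha1, ha2, hF, LinearEquiv.apply_symm_apply]
  · refine LinearMap.ext fun v => ?_
    rw [Units.val_mul, Units.val_mul, Matrix.toLin'_mul, Matrix.toLin'_mul, LinearMap.comp_apply,
      LinearMap.comp_apply, ha1, ha2, hG, LinearEquiv.symm_apply_apply]

end Group

end ZClass

/-- If `k` is a perfect field of type (F), i.e. with only finitely many extensions of each
degree inside a fixed algebraic closure, then `GL n k` has only finitely many z-classes. -/
theorem finitely_many_zClasses_GL_of_typeF (k : Type*) [Field k] [PerfectField k]
    (hk : ∀ m : ℕ, 0 < m →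
      {K : IntermediateField k (AlgebraicClosure k) | Module.finrank k K = m}.Finite)
    (n : ℕ) (hn : 0 < n) :
    {C : Set (GL (Fin n) k) | ∃ g : GL (Fin n) k, C = {h : GL (Fin n) k | IsZEquiv g h}}.Finite := by
  let N := Module.finrank k (Fin n → k)
  let 𝒦 := {K : IntermediateField k (AlgebraicClosure k) | Module.finrank k K ∈ Finset.Icc 1 N}
  have h𝒦 : Finite 𝒦 := by
    refine Set.Finite.subset ((Finset.Icc 1 N).finite_toSet.biUnion fun m hm =>
      hk m (Finset.mem_Icc.1 hm).1) fun K hK => ?_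
    exact Set.mem_biUnion (x := Module.finrank k K) hK rfl
  let D := Σ r : Fin (N + 1), (Fin r → 𝒦) × (Fin r → Fin (N + 1)) × (Fin r → Fin r → Prop)
  have hD (g : GL (Fin n) k) : ∃ d : D, ZClass.HasModel (Matrix.toLin' g.1)
      (fun i => (d.2.1 i).1) (fun i => d.2.2.1 i) d.2.2.2 := by
    obtain ⟨r, K, e, rel, h, hK⟩ :=
      ZClass.exists_hasModel_fin (AlgebraicClosure k) (Matrix.toLin' g.1)
    exact ⟨⟨r, fun i => ⟨K i, hK i⟩, e, rel⟩, h⟩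
  choose d hd using hD
  have hcls (g h : GL (Fin n) k) (hgh : d g = d h) : IsZEquiv g h := by
    have hg := hd g
    rw [hgh] at hg
    obtain ⟨T, F, G, hF, hG⟩ := hg.exists_conj_eq_aeval (hd h)
    exact ZClass.isZEquiv_of_conj_eq_aeval hF hG
  have : Finite (Set.range d) := inferInstance
  choose s hs using fun c : Set.range d => c.2
  refine (Set.finite_range fun c => {h | IsZEquiv (s c) h}).subset ?_
  rintro C ⟨g, rfl⟩
  have h := hcls _ _ (hs ⟨d g, g, rfl⟩)
  exact ⟨⟨d g, g, rfl⟩, Set.ext fun x =>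
    ⟨fun hx => h.symm.trans hx, fun hx => h.trans hx⟩⟩
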